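/- Let 0 < Y < 1 and G > 0. Then ∫_{0}^{∞} (e^{-z} − 1 + z) e^{-Gz} z^{-(1+Y)} dz = Γ(−Y) · ((G+1)^{Y} − G^{Y} − Y·G^{Y−1}), where Γ denotes the Gamma function extended to negative non-integer arguments. (This is the negative-jump contribution to the exponential compensator ∫_ℝ (e^{z} − 1 − z) ν(dz) of the CGMY process.) -/

import Mathlib

open MeasureTheory Real

lemma integrableOn_rpow_mul_exp_neg_mul_Ioi {a r : ℝ} (ha : 0 < a) (hr : 0 < r) :
    IntegrableOn (fun z : ℝ => z ^ (a - 1) * exp (-(r * z))) (Set.Ioi 0) := by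
  simpa [neg_mul] using
    integrableOn_rpow_mul_exp_neg_mul_rpow (s := a - 1) (by linarith) one_pos hr

lemma abs_exp_neg_sub_one_add_self_le {z : ℝ} (hz : 0 ≤ z) : |exp (-z) - 1 + z| ≤ z := by
  have h₁ := add_one_le_exp (-z)
  have h₂ : exp (-z) ≤ 1 := exp_le_one_iff.2 (by linarith)
  rw [abs_of_nonneg (by linarith)]
  linarith

lemma abs_compensated_exp_mul_rpow_le {G z : ℝ} (s : ℝ) (hz : 0 < z) :
    |(exp (-z) - 1 + z) * exp (-G * z) * z ^ s| ≤ z ^ (s + 1) * exp (-G * z) := by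
  rw [abs_mul, abs_mul, abs_exp, abs_of_nonneg (rpow_nonneg hz.le s), rpow_add_one hz.ne']
  calc |exp (-z) - 1 + z| * exp (-G * z) * z ^ s
      ≤ z * exp (-G * z) * z ^ s := by
        gcongr
        exact abs_exp_neg_sub_one_add_self_le hz.le
    _ = z ^ s * z * exp (-G * z) := by ring

lemma integrableOn_compensated_exp_mul_rpow {Y G : ℝ} (hY1 : Y < 1) (hG : 0 < G) :
    IntegrableOn (fun z : ℝ => (exp (-z) - 1 + z) * exp (-G * z) * z ^ (-(1 + Y)))
      (Set.Ioi 0) := by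
  refine Integrable.mono' (integrableOn_rpow_mul_exp_neg_mul_Ioi (sub_pos.2 hY1) hG)
    (by fun_prop) ?_
  filter_upwards [ae_restrict_mem measurableSet_Ioi] with z hz
  have h := abs_compensated_exp_mul_rpow_le (G := G) (-(1 + Y)) hz
  rw [show -(1 + Y) + 1 = 1 - Y - 1 by ring] at h
  rwa [norm_eq_abs, ← neg_mul]

lemma hasDerivAt_compensated_exp_mul_rpow (Y G : ℝ) {z : ℝ} (hz : 0 < z) :
    HasDerivAt (fun z : ℝ => (exp (-z) - 1 + z) * exp (-G * z) * z ^ (-Y))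
      (-(G + 1) * (z ^ (1 - Y - 1) * exp (-((G + 1) * z)))
        + (G + 1) * (z ^ (1 - Y - 1) * exp (-(G * z)))
        - G * (z ^ (2 - Y - 1) * exp (-(G * z)))
        - Y * ((exp (-z) - 1 + z) * exp (-G * z) * z ^ (-(1 + Y)))) z := by
  have h₁ : HasDerivAt (fun z : ℝ => exp (-z) - 1 + z) (exp (-z) * -1 + 1) z :=
    (((hasDerivAt_id z).neg.exp).sub_const 1).add (hasDerivAt_id z)
  have h₂ : HasDerivAt (fun z : ℝ => exp (-G * z)) (exp (-G * z) * (-G * 1)) z :=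
    ((hasDerivAt_id z).const_mul (-G)).exp
  have h₃ := hasDerivAt_rpow_const (p := -Y) (Or.inl hz.ne')
  refine ((h₁.mul h₂).mul h₃).congr_deriv ?_
  rw [show 1 - Y - 1 = -Y by ring, show 2 - Y - 1 = -Y + 1 by ring,
    show -(1 + Y) = -Y - 1 by ring, rpow_add_one hz.ne',
    show -((G + 1) * z) = -G * z + -z by ring, exp_add, ← neg_mul]
  simp only [Pi.mul_apply]
  ring

lemma integral_deriv_compensated_exp_mul_rpow {Y G : ℝ} (hY1 : Y < 1) (hG : 0 < G) :
    ∫ z in Set.Ioi (0 : ℝ), (-(G + 1) * (z ^ (1 - Y - 1) * exp (-((G + 1) * z)))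
        + (G + 1) * (z ^ (1 - Y - 1) * exp (-(G * z)))
        - G * (z ^ (2 - Y - 1) * exp (-(G * z)))
        - Y * ((exp (-z) - 1 + z) * exp (-G * z) * z ^ (-(1 + Y)))) =
      -(G + 1) * ((1 / (G + 1)) ^ (1 - Y) * Gamma (1 - Y))
        + (G + 1) * ((1 / G) ^ (1 - Y) * Gamma (1 - Y))
        - G * ((1 / G) ^ (2 - Y) * Gamma (2 - Y))
        - Y * ∫ z in Set.Ioi (0 : ℝ), (exp (-z) - 1 + z) * exp (-G * z) * z ^ (-(1 + Y)) := by
  have i₁ := (integrableOn_rpow_mul_exp_neg_mul_Ioi (sub_pos.2 hY1)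
    (by linarith : 0 < G + 1)).const_mul (-(G + 1))
  have i₂ := (integrableOn_rpow_mul_exp_neg_mul_Ioi (sub_pos.2 hY1) hG).const_mul (G + 1)
  have i₃ := (integrableOn_rpow_mul_exp_neg_mul_Ioi (by linarith : 0 < 2 - Y) hG).const_mul G
  have i₄ := (integrableOn_compensated_exp_mul_rpow hY1 hG).const_mul Y
  refine (integral_sub ((i₁.add i₂).sub i₃) i₄).trans ?_
  rw [integral_sub' (i₁.add i₂) i₃, integral_add' i₁ i₂]
  simp only [integral_const_mul]
  rw [integral_rpow_mul_exp_neg_mul_Ioi (sub_pos.2 hY1) (by linarith),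
    integral_rpow_mul_exp_neg_mul_Ioi (sub_pos.2 hY1) hG,
    integral_rpow_mul_exp_neg_mul_Ioi (by linarith) hG]

lemma integral_deriv_compensated_exp_mul_rpow_eq_zero {Y G : ℝ} (hY1 : Y < 1) (hG : 0 < G) :
    ∫ z in Set.Ioi (0 : ℝ), (-(G + 1) * (z ^ (1 - Y - 1) * exp (-((G + 1) * z)))
        + (G + 1) * (z ^ (1 - Y - 1) * exp (-(G * z)))
        - G * (z ^ (2 - Y - 1) * exp (-(G * z)))
        - Y * ((exp (-z) - 1 + z) * exp (-G * z) * z ^ (-(1 + Y)))) = 0 := by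
  have i₁ := (integrableOn_rpow_mul_exp_neg_mul_Ioi (sub_pos.2 hY1)
    (by linarith : 0 < G + 1)).const_mul (-(G + 1))
  have i₂ := (integrableOn_rpow_mul_exp_neg_mul_Ioi (sub_pos.2 hY1) hG).const_mul (G + 1)
  have i₃ := (integrableOn_rpow_mul_exp_neg_mul_Ioi (by linarith : 0 < 2 - Y) hG).const_mul G
  have i₄ := (integrableOn_compensated_exp_mul_rpow hY1 hG).const_mul Y
  have hzero : (exp (-0) - 1 + 0) * exp (-G * 0) * (0 : ℝ) ^ (-Y) = 0 := by simp
  have hcont : ContinuousWithinAt (fun z : ℝ => (exp (-z) - 1 + z) * exp (-G * z) * z ^ (-Y))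
      (Set.Ici 0) 0 := by
    rw [ContinuousWithinAt, hzero]
    have hbound : Filter.Tendsto (fun z : ℝ => z ^ (-Y + 1) * exp (-G * z))
        (nhdsWithin 0 (Set.Ici 0)) (nhds 0) := by
      have : ContinuousAt (fun z : ℝ => z ^ (-Y + 1) * exp (-G * z)) 0 :=
        (continuousAt_rpow_const _ _ (Or.inr (by linarith))).mul (by fun_prop)
      have h := this.tendsto.mono_left (nhdsWithin_le_nhds (s := Set.Ici 0))
      simpa [zero_rpow (by linarith : -Y + 1 ≠ 0)] using h
    refine squeeze_zero_norm' ?_ hbound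
    filter_upwards [self_mem_nhdsWithin] with z hz
    rcases (Set.mem_Ici.1 hz).eq_or_lt with rfl | hz
    · simp [zero_rpow (by linarith : -Y + 1 ≠ 0)]
    · exact abs_compensated_exp_mul_rpow_le (-Y) hz
  have htop : Filter.Tendsto (fun z : ℝ => (exp (-z) - 1 + z) * exp (-G * z) * z ^ (-Y))
      Filter.atTop (nhds 0) := by
    refine squeeze_zero_norm' ?_ (tendsto_rpow_mul_exp_neg_mul_atTop_nhds_zero (-Y + 1) G hG)
    filter_upwards [Filter.eventually_gt_atTop 0] with z hz
    exact abs_compensated_exp_mul_rpow_le (-Y) hz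
  rw [integral_Ioi_of_hasDerivAt_of_tendsto hcont
    (fun z hz => hasDerivAt_compensated_exp_mul_rpow Y G hz)
    (((i₁.add i₂).sub i₃).sub i₄) htop, hzero, sub_zero]

/-- Negative-jump contribution to the exponential compensator of the CGMY process:
for `0 < Y < 1` and `G > 0`,
`∫_0^∞ (e^(-z) − 1 + z) e^(-Gz) z^(-(1+Y)) dz = Γ(−Y) ((G+1)^Y − G^Y − Y G^(Y−1))`. -/
theorem cgmy_negative_jump_compensator (Y G : ℝ) (hY0 : 0 < Y) (hY1 : Y < 1) (hG : 0 < G) :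
    ∫ z in Set.Ioi (0:ℝ), (Real.exp (-z) - 1 + z) * Real.exp (-G * z) * z ^ (-(1 + Y))
      = Real.Gamma (-Y) * ((G + 1) ^ Y - G ^ Y - Y * G ^ (Y - 1)) := by
  have key := (integral_deriv_compensated_exp_mul_rpow hY1 hG).symm.trans
    (integral_deriv_compensated_exp_mul_rpow_eq_zero hY1 hG)
  have hG1 : 0 < G + 1 := by linarith
  have hΓ₁ : Gamma (1 - Y) = -Y * Gamma (-Y) := by
    rw [← Gamma_add_one (neg_ne_zero.2 hY0.ne'), neg_add_eq_sub]
  have hΓ₂ : Gamma (2 - Y) = (1 - Y) * Gamma (1 - Y) := by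
    rw [← Gamma_add_one (by linarith : 1 - Y ≠ 0)]
    ring_nf
  have hpow {r : ℝ} (hr : 0 < r) (s : ℝ) : (1 / r) ^ s = r ^ (-s) := by
    rw [one_div, inv_rpow hr.le, rpow_neg hr.le]
  rw [hpow hG1, hpow hG, hpow hG, hΓ₂, hΓ₁, neg_sub, neg_sub, rpow_sub_one hG1.ne',
    rpow_sub_one hG.ne', show Y - 2 = Y - 1 - 1 by ring, rpow_sub_one hG.ne' (Y - 1),
    rpow_sub_one hG.ne'] at key
  rw [rpow_sub_one hG.ne']
  apply mul_left_cancel₀ hY0.ne'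
  rw [← sub_eq_zero.1 key]
  field_simp
  ring
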